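/- arXiv:1907.13616 — 5 statements merged into one kernel-verified Lean document; each statement's English description precedes it below -/
import Mathlib

section
/- Let d ≥ 1 and let f : ℝ^d → ℝ have L_H-Lipschitz Hessian with L_H > 0. Let M ≥ L_H, let x, g, h ∈ ℝ^d and let H be a symmetric d×d real matrix such that h satisfies the cubic-model optimality conditions for (g, H, M). Then (M/36)·‖h‖³ ≤ f(x) − f(x + h) + (4/√(3M))·‖∇f(x) − g‖^{3/2} + (24/M²)·‖∇²f(x) − H‖_op³. -/
open scoped RealInnerProductSpace

/-- The spectral (operator) norm of a square real matrix, i.e. the operator norm of the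
induced continuous linear endomorphism of Euclidean space. -/
noncomputable def matOpNorm {d : ℕ} (A : Matrix (Fin d) (Fin d) ℝ) : ℝ :=
  ‖Matrix.toEuclideanCLM (𝕜 := ℝ) A‖

/-- The cubic-model optimality conditions for `(g, H, M)` at the step `h`:
(i) `g + H h + (M/2)‖h‖ h = 0`; (ii) `H + (M/2)‖h‖ I ⪰ 0`; (iii) `⟪g, h⟫ ≤ 0`. -/
def CubicOptConditions {d : ℕ} (g : EuclideanSpace ℝ (Fin d))
    (H : Matrix (Fin d) (Fin d) ℝ) (M : ℝ) (h : EuclideanSpace ℝ (Fin d)) : Prop :=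
  g + (Matrix.toEuclideanCLM (𝕜 := ℝ) H) h + ((M / 2) * ‖h‖) • h = 0 ∧
  (H + ((M / 2) * ‖h‖) • (1 : Matrix (Fin d) (Fin d) ℝ)).PosSemidef ∧
  ⟪g, h⟫ ≤ 0

theorem le_of_hasDerivAt_nonpos {u u' : ℝ → ℝ} (hu : ∀ t, HasDerivAt u (u' t) t)
    (hu' : ∀ t, 0 ≤ t → u' t ≤ 0) {t : ℝ} (ht : 0 ≤ t) : u t ≤ u 0 := by
  have hanti : AntitoneOn u (Set.Ici 0) :=
    antitoneOn_of_hasDerivWithinAt_nonpos (convex_Ici 0)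
      (fun t _ => (hu t).continuousAt.continuousWithinAt)
      (fun t _ => (hu t).hasDerivWithinAt)
      (fun t ht => hu' t (interior_subset ht))
  exact hanti Set.self_mem_Ici ht ht

/-- Second-order Taylor upper bound for a function with Lipschitz Hessian. -/
theorem taylor_upper_bound_of_lipschitz_hessian {E : Type*} [NormedAddCommGroup E]
    [InnerProductSpace ℝ E] [CompleteSpace E] {f : E → ℝ} (hf : Differentiable ℝ f)
    {A : E → E →L[ℝ] E} (hA : ∀ y, HasFDerivAt (fun z => gradient f z) (A y) y)
    {L : ℝ} (hL : ∀ a b, ‖A a - A b‖ ≤ L * ‖a - b‖) (x h : E) :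
    f (x + h) ≤ f x + ⟪gradient f x, h⟫ + ⟪A x h, h⟫ / 2 + L / 6 * ‖h‖ ^ 3 := by
  have hline (t : ℝ) : HasDerivAt (fun t : ℝ => x + t • h) h t := by
    simpa using ((hasDerivAt_id t).smul_const h).const_add x
  have hgrad (t : ℝ) :
      HasDerivAt (fun t : ℝ => ⟪gradient f (x + t • h), h⟫ - ⟪gradient f x, h⟫
        - t * ⟪A x h, h⟫ - L * ‖h‖ ^ 3 * t ^ 2 / 2)
        (⟪A (x + t • h) h, h⟫ - ⟪A x h, h⟫ - L * ‖h‖ ^ 3 * t) t := by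
    have h1 := ((hA (x + t • h)).comp_hasDerivAt t (hline t)).inner ℝ (hasDerivAt_const t h)
    have h2 := ((h1.sub_const ⟪gradient f x, h⟫).sub
      ((hasDerivAt_id t).mul_const ⟪A x h, h⟫)).sub
      (((hasDerivAt_pow 2 t).const_mul (L * ‖h‖ ^ 3)).div_const 2)
    refine h2.congr_deriv ?_
    simp
    ring
  have hval (t : ℝ) :
      HasDerivAt (fun t : ℝ => f (x + t • h) - t * ⟪gradient f x, h⟫
        - ⟪A x h, h⟫ * t ^ 2 / 2 - L * ‖h‖ ^ 3 * t ^ 3 / 6)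
        (⟪gradient f (x + t • h), h⟫ - ⟪gradient f x, h⟫
          - t * ⟪A x h, h⟫ - L * ‖h‖ ^ 3 * t ^ 2 / 2) t := by
    have h1 := (hf (x + t • h)).hasGradientAt.hasFDerivAt.comp_hasDerivAt t (hline t)
    have h2 := ((h1.sub ((hasDerivAt_id t).mul_const ⟪gradient f x, h⟫)).sub
      (((hasDerivAt_pow 2 t).const_mul ⟪A x h, h⟫).div_const 2)).sub
      (((hasDerivAt_pow 3 t).const_mul (L * ‖h‖ ^ 3)).div_const 6)
    refine h2.congr_deriv ?_
    simp
    ring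
  have hcurv (t : ℝ) (ht : 0 ≤ t) :
      ⟪A (x + t • h) h, h⟫ - ⟪A x h, h⟫ - L * ‖h‖ ^ 3 * t ≤ 0 := by
    have hnorm : ‖A (x + t • h) - A x‖ ≤ L * (t * ‖h‖) := by
      simpa [norm_smul, abs_of_nonneg ht] using hL (x + t • h) x
    have hinner := (A (x + t • h) - A x).le_opNorm h
    have hcs := real_inner_le_norm ((A (x + t • h) - A x) h) h
    rw [sub_apply, inner_sub_left] at hcs
    rw [sub_apply] at hinner
    have hbound := hinner.trans (mul_le_mul_of_nonneg_right hnorm (norm_nonneg h))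
    have := mul_le_mul_of_nonneg_right hbound (norm_nonneg h)
    linarith
  have hslope (t : ℝ) (ht : 0 ≤ t) := le_of_hasDerivAt_nonpos hgrad hcurv ht
  have hmain := le_of_hasDerivAt_nonpos hval
    (fun t ht => (hslope t ht).trans (by simp)) zero_le_one
  simp only [one_smul, zero_smul, add_zero] at hmain
  linarith

theorem mul_le_cube_add_rpow {M e r : ℝ} (hM : 0 < M) (he : 0 ≤ e) (hr : 0 ≤ r) :
    e * r ≤ M / 36 * r ^ 3 + 4 / √(3 * M) * e ^ ((3 : ℝ) / 2) := by
  have hq : 0 ≤ √e := Real.sqrt_nonneg e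
  have he2 : √e ^ 2 = e := Real.sq_sqrt he
  have hpow : e ^ ((3 : ℝ) / 2) = √e ^ 3 := by
    rw [Real.sqrt_eq_rpow, ← Real.rpow_mul_natCast he]
    norm_num
  have hc : 0 < √(3 * M) := by positivity
  have hc2 : √(3 * M) ^ 2 = 3 * M := Real.sq_sqrt (by positivity)
  rw [hpow]
  generalize √e = q at *
  generalize √(3 * M) = c at *
  obtain rfl : M = c ^ 2 / 3 := by linarith
  subst he2
  have key : 0 ≤ (c * r - 6 * q) ^ 2 * (c * r + 12 * q) / (108 * c) := by positivity
  have : (c * r - 6 * q) ^ 2 * (c * r + 12 * q) / (108 * c) =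
      c ^ 2 / 3 / 36 * r ^ 3 + 4 / c * q ^ 3 - q ^ 2 * r := by
    field_simp
    ring
  linarith

theorem mul_sq_le_cube_add_cube {M e r : ℝ} (hM : 0 < M) (he : 0 ≤ e) (hr : 0 ≤ r) :
    e * r ^ 2 / 2 ≤ M / 36 * r ^ 3 + 24 / M ^ 2 * e ^ 3 := by
  have key : 0 ≤ (M * r - 12 * e) ^ 2 * (M * r + 6 * e) / (36 * M ^ 2) := by positivity
  have : (M * r - 12 * e) ^ 2 * (M * r + 6 * e) / (36 * M ^ 2) =
      M / 36 * r ^ 3 + 24 / M ^ 2 * e ^ 3 - e * r ^ 2 / 2 := by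
    field_simp
    ring
  linarith

/-- **Cubic-regularized Newton step decrease with inexact gradient and Hessian.**
If `f` has `L_H`-Lipschitz Hessian `Hf`, `M ≥ L_H`, and `h` satisfies the cubic-model
optimality conditions for `(g, H, M)`, then
`(M/36)‖h‖³ ≤ f x − f (x+h) + (4/√(3M))‖∇f x − g‖^{3/2} + (24/M²)‖∇²f x − H‖_op³`. -/
theorem cubic_step_function_value_decrease
    (d : ℕ) (hd : 1 ≤ d) (L_H M : ℝ) (hLH : 0 < L_H) (hM : L_H ≤ M)
    (f : EuclideanSpace ℝ (Fin d) → ℝ) (hf : Differentiable ℝ f)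
    (Hf : EuclideanSpace ℝ (Fin d) → Matrix (Fin d) (Fin d) ℝ)
    (hHess : ∀ y, HasFDerivAt (fun z => gradient f z)
      (Matrix.toEuclideanCLM (𝕜 := ℝ) (Hf y)) y)
    (hHsymm : ∀ y, (Hf y).IsHermitian)
    (hHessLip : ∀ a b, matOpNorm (Hf a - Hf b) ≤ L_H * ‖a - b‖)
    (x g h : EuclideanSpace ℝ (Fin d)) (H : Matrix (Fin d) (Fin d) ℝ)
    (hHsym : H.IsHermitian)
    (hopt : CubicOptConditions g H M h) :
    (M / 36) * ‖h‖ ^ 3 ≤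
      f x - f (x + h) + (4 / Real.sqrt (3 * M)) * ‖gradient f x - g‖ ^ ((3 : ℝ) / 2)
        + (24 / M ^ 2) * (matOpNorm (Hf x - H)) ^ 3 := by
  have hMpos : 0 < M := hLH.trans_le hM
  obtain ⟨hstat, -, hdesc⟩ := hopt
  have htaylor := taylor_upper_bound_of_lipschitz_hessian hf hHess (L := L_H)
    (fun a b => by simpa [matOpNorm] using hHessLip a b) x h
  have hstat' : ⟪g, h⟫ + ⟪Matrix.toEuclideanCLM (𝕜 := ℝ) H h, h⟫ + M / 2 * ‖h‖ ^ 3 = 0 := by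
    have := congrArg (fun v => ⟪v, h⟫) hstat
    simp only [inner_add_left, real_inner_smul_left, inner_zero_left,
      real_inner_self_eq_norm_sq] at this
    linarith
  have hgrad : ⟪gradient f x, h⟫ - ⟪g, h⟫ ≤ ‖gradient f x - g‖ * ‖h‖ := by
    rw [← inner_sub_left]
    exact real_inner_le_norm _ _
  have hcurv : ⟪Matrix.toEuclideanCLM (𝕜 := ℝ) (Hf x) h, h⟫
      - ⟪Matrix.toEuclideanCLM (𝕜 := ℝ) H h, h⟫ ≤ matOpNorm (Hf x - H) * ‖h‖ ^ 2 := by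
    rw [← inner_sub_left, ← sub_apply, ← map_sub, sq, ← mul_assoc]
    exact (real_inner_le_norm _ _).trans
      (mul_le_mul_of_nonneg_right (ContinuousLinearMap.le_opNorm _ _) (norm_nonneg h))
  have hyoung₁ := mul_le_cube_add_rpow hMpos (norm_nonneg (gradient f x - g)) (norm_nonneg h)
  have hyoung₂ := mul_sq_le_cube_add_cube hMpos
    (e := matOpNorm (Hf x - H)) (norm_nonneg _) (norm_nonneg h)
  have hLM : L_H * ‖h‖ ^ 3 ≤ M * ‖h‖ ^ 3 := by gcongr
  linarith
end

section
/- Let d ≥ 1 and let f : ℝ^d → ℝ have L_G-Lipschitz gradient and L_H-Lipschitz Hessian, with L_G, L_H > 0. Let x, g, h ∈ ℝ^d and let H be a symmetric d×d real matrix such that h satisfies the cubic-model optimality conditions for (g, H, L_H). Then max(‖∇f(x)‖, (−(2/L_H)·λ_min(∇²f(x)))³) ≤ L_G·‖h‖ + 2L_H·‖h‖² + 4‖h‖³ + ‖∇f(x) − g‖ + ‖∇²f(x) − H‖_op²/(4L_H) + (32/L_H³)·‖H − ∇²f(x)‖_op³. -/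
open scoped RealInnerProductSpace

/-- The smallest eigenvalue of a symmetric matrix `A`, as the infimum of `⟪A v, v⟫` over
unit vectors `v`. -/
noncomputable def lambdaMin {d : ℕ} (A : Matrix (Fin d) (Fin d) ℝ) : ℝ :=
  sInf {r : ℝ | ∃ v : EuclideanSpace ℝ (Fin d), ‖v‖ = 1 ∧
    r = ⟪(Matrix.toEuclideanCLM (𝕜 := ℝ) A) v, v⟫}

/-- The quadratic form of a real positive semidefinite matrix is nonnegative. -/
theorem Matrix.PosSemidef.inner_toEuclideanCLM_nonneg {d : ℕ} {A : Matrix (Fin d) (Fin d) ℝ}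
    (hA : A.PosSemidef) (v : EuclideanSpace ℝ (Fin d)) :
    0 ≤ ⟪(Matrix.toEuclideanCLM (𝕜 := ℝ) A) v, v⟫ := by
  have hv := hA.dotProduct_mulVec_nonneg v.ofLp
  rw [EuclideanSpace.inner_eq_star_dotProduct, Matrix.ofLp_toEuclideanCLM]
  simpa [dotProduct_comm] using hv

theorem matOpNorm_sub_comm {d : ℕ} (A B : Matrix (Fin d) (Fin d) ℝ) :
    matOpNorm (A - B) = matOpNorm (B - A) := by
  simp only [matOpNorm, map_sub, norm_sub_rev]

/-- A shift making `A` positive semidefinite bounds the smallest eigenvalue of `B` from below,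
up to the distance between `A` and `B`. -/
theorem neg_add_matOpNorm_le_lambdaMin {d : ℕ} {A B : Matrix (Fin d) (Fin d) ℝ} {c : ℝ}
    (hc : 0 ≤ c) (hA : (A + c • (1 : Matrix (Fin d) (Fin d) ℝ)).PosSemidef) :
    -(c + matOpNorm (A - B)) ≤ lambdaMin B := by
  have hE : 0 ≤ matOpNorm (A - B) := norm_nonneg _
  refine Real.le_sInf ?_ (by linarith)
  rintro _ ⟨v, hv, rfl⟩
  have hpos := hA.inner_toEuclideanCLM_nonneg v
  have hdiff : ⟪(Matrix.toEuclideanCLM (𝕜 := ℝ) (A - B)) v, v⟫ ≤ matOpNorm (A - B) := by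
    have hle := (Matrix.toEuclideanCLM (𝕜 := ℝ) (A - B)).le_opNorm v
    have hcs := real_inner_le_norm ((Matrix.toEuclideanCLM (𝕜 := ℝ) (A - B)) v) v
    rw [hv, mul_one] at hle hcs
    exact hcs.trans hle
  simp only [map_add, map_smul, map_one, map_sub, add_apply,
    sub_apply, smul_apply,
    one_apply_eq_self, inner_add_left, inner_sub_left, real_inner_smul_left,
    real_inner_self_eq_norm_sq, hv] at hpos hdiff
  simp only [matOpNorm, map_sub] at hdiff ⊢
  linarith

/-- **Second-order stationarity bound for the inexact cubic-regularized Newton step.**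
If `f` has `L_G`-Lipschitz gradient and `L_H`-Lipschitz Hessian `Hf`, and `h` satisfies the
cubic-model optimality conditions for `(g, H, L_H)`, then
`max(‖∇f x‖, (−(2/L_H) λ_min(∇²f x))³) ≤ L_G ‖h‖ + 2 L_H ‖h‖² + 4 ‖h‖³ + ‖∇f x − g‖
  + ‖∇²f x − H‖_op²/(4 L_H) + (32/L_H³) ‖H − ∇²f x‖_op³`. -/
theorem cubic_step_second_order_stationarity
    (d : ℕ) (hd : 1 ≤ d) (L_G L_H : ℝ) (hLG : 0 < L_G) (hLH : 0 < L_H)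
    (f : EuclideanSpace ℝ (Fin d) → ℝ) (hf : Differentiable ℝ f)
    (hGradLip : ∀ a b, ‖gradient f a - gradient f b‖ ≤ L_G * ‖a - b‖)
    (Hf : EuclideanSpace ℝ (Fin d) → Matrix (Fin d) (Fin d) ℝ)
    (hHess : ∀ y, HasFDerivAt (fun z => gradient f z)
      (Matrix.toEuclideanCLM (𝕜 := ℝ) (Hf y)) y)
    (hHsymm : ∀ y, (Hf y).IsHermitian)
    (hHessLip : ∀ a b, matOpNorm (Hf a - Hf b) ≤ L_H * ‖a - b‖)
    (x g h : EuclideanSpace ℝ (Fin d)) (H : Matrix (Fin d) (Fin d) ℝ)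
    (hHsym : H.IsHermitian)
    (hopt : CubicOptConditions g H L_H h) :
    max ‖gradient f x‖ ((-(2 / L_H) * lambdaMin (Hf x)) ^ 3) ≤
      L_G * ‖h‖ + 2 * L_H * ‖h‖ ^ 2 + 4 * ‖h‖ ^ 3 + ‖gradient f x - g‖
        + (matOpNorm (Hf x - H)) ^ 2 / (4 * L_H)
        + (32 / L_H ^ 3) * (matOpNorm (H - Hf x)) ^ 3 := by
  obtain ⟨hstat, hpsd, -⟩ := hopt
  rw [matOpNorm_sub_comm (Hf x) H]
  have hr : 0 ≤ ‖h‖ := norm_nonneg h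
  have hE : 0 ≤ matOpNorm (H - Hf x) := norm_nonneg _
  have hlam := neg_add_matOpNorm_le_lambdaMin (B := Hf x) (by positivity) hpsd
  have hHf : ‖Matrix.toEuclideanCLM (𝕜 := ℝ) (Hf x)‖ ≤ L_G :=
    (hHess x).le_of_lip' hLG.le (Filter.Eventually.of_forall fun y => hGradLip y x)
  have hdiff : ‖Matrix.toEuclideanCLM (𝕜 := ℝ) (H - Hf x) h‖ ≤ matOpNorm (H - Hf x) * ‖h‖ :=
    ContinuousLinearMap.le_opNorm _ _
  have hHfh := (Matrix.toEuclideanCLM (𝕜 := ℝ) (Hf x)).le_of_opNorm_le hHf h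
  set r := ‖h‖
  set E := matOpNorm (H - Hf x)
  have hcube : 0 ≤ 32 / L_H ^ 3 * E ^ 3 := by positivity
  have hsq : 0 ≤ E ^ 2 / (4 * L_H) := by positivity
  apply max_le
  · have hdecomp : gradient f x = (gradient f x - g)
        - Matrix.toEuclideanCLM (𝕜 := ℝ) (Hf x) h
        - Matrix.toEuclideanCLM (𝕜 := ℝ) (H - Hf x) h - ((L_H / 2) * r) • h := by
      rw [map_sub, sub_apply]
      linear_combination (norm := module) hstat
    have hsmul : ‖((L_H / 2) * r) • h‖ = L_H / 2 * r ^ 2 := by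
      rw [norm_smul, Real.norm_of_nonneg (by positivity)]
      ring
    have htri : ‖gradient f x‖ ≤ ‖gradient f x - g‖ + L_G * r + E * r + L_H / 2 * r ^ 2 := by
      rw [← hsmul]
      conv_lhs => rw [hdecomp]
      refine (norm_sub_le _ _).trans ?_
      gcongr
      refine (norm_sub_le _ _).trans ?_
      gcongr
      refine (norm_sub_le _ _).trans ?_
      gcongr
    have hyoung : E * r ≤ E ^ 2 / (4 * L_H) + L_H * r ^ 2 := by
      have hid : E ^ 2 / (4 * L_H) + L_H * r ^ 2 - E * r = (E - 2 * L_H * r) ^ 2 / (4 * L_H) := by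
        field_simp
        ring
      have : 0 ≤ (E - 2 * L_H * r) ^ 2 / (4 * L_H) := by positivity
      linarith
    have : 0 ≤ L_H * r ^ 2 := by positivity
    have : 0 ≤ r ^ 3 := by positivity
    linarith
  · have hbase : -(2 / L_H) * lambdaMin (Hf x) ≤ r + 2 * E / L_H := by
      calc -(2 / L_H) * lambdaMin (Hf x) = 2 / L_H * -lambdaMin (Hf x) := by ring
        _ ≤ 2 / L_H * (L_H / 2 * r + E) := by gcongr; linarith
        _ = r + 2 * E / L_H := by field_simp
    have hpow : (r + 2 * E / L_H) ^ 3 ≤ 4 * (r ^ 3 + (2 * E / L_H) ^ 3) := by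
      have := add_pow_le hr (by positivity : 0 ≤ 2 * E / L_H) 3
      norm_num at this ⊢
      exact this
    have hrew : 4 * (r ^ 3 + (2 * E / L_H) ^ 3) = 4 * r ^ 3 + 32 / L_H ^ 3 * E ^ 3 := by
      field_simp
      ring
    have hmono := (Odd.strictMono_pow (by decide : Odd 3)).monotone hbase
    have : 0 ≤ L_G * r := by positivity
    have : 0 ≤ L_H * r ^ 2 := by positivity
    have : 0 ≤ ‖gradient f x - g‖ := norm_nonneg _
    linarith
end

section
/- Fix integers d, T ≥ 1 and reals L_G, L_H > 0, W_T ≥ 0. Let f_1, …, f_T : ℝ^d → ℝ each have L_G-Lipschitz gradient and L_H-Lipschitz Hessian, and have variation budget W_T. Fix x_1 ∈ ℝ^d and suppose that for each t = 1, …, T the point x_{t+1} is a global minimizer over ℝ^d of the cubic model y ↦ ⟨∇f_t(x_t), y − x_t⟩ + (1/2)⟨∇²f_t(x_t)(y − x_t), y − x_t⟩ + (L_H/6)·‖y − x_t‖³. Then there exists a constant C > 0 depending only on L_G and L_H (and not on d, T, W_T, or the functions) such that ∑_{t=1}^T max(‖∇f_t(x_t)‖, (−(2/L_H)·λ_min(∇²f_t(x_t)))³)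 ≤ C·T^{2/3}·(1 + W_T + max(0, f_1(x_1) − f_T(x_{T+1}))). -/
open scoped RealInnerProductSpace

section CubicModel

variable {E : Type*} [NormedAddCommGroup E] [InnerProductSpace ℝ E]

/-- The cubic-regularized second-order model with gradient `g`, Hessian `A` and regularization
parameter `M`, as a function of the displacement `h`. -/
noncomputable def cubicModel (g : E) (A : E →L[ℝ] E) (M : ℝ) (h : E) : ℝ :=
  ⟪g, h⟫ + (1 / 2) * ⟪A h, h⟫ + (M / 6) * ‖h‖ ^ 3

/-- The second-order Taylor upper bound for a function with `M`-Lipschitz Hessian. -/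
theorem le_add_cubicModel_of_lipschitz_hessian [CompleteSpace E] {f : E → ℝ} {A : E → E →L[ℝ] E}
    {M : ℝ} (hf : Differentiable ℝ f) (hA : ∀ y, HasFDerivAt (fun z => gradient f z) (A y) y)
    (hM : ∀ a b, ‖A a - A b‖ ≤ M * ‖a - b‖) (x h : E) :
    f (x + h) ≤ f x + cubicModel (gradient f x) (A x) M h := by
  have hline : ∀ s : ℝ, HasDerivAt (fun s : ℝ => x + s • h) h s := fun s => by
    simpa using ((hasDerivAt_id s).smul_const h).const_add x
  have hf' : ∀ s : ℝ, HasDerivAt (fun s : ℝ => f (x + s • h)) ⟪gradient f (x + s • h), h⟫ s := by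
    intro s
    have h1 := HasFDerivAt.comp_hasDerivAt (f := fun s : ℝ => x + s • h) s
      (hf (x + s • h)).hasGradientAt.hasFDerivAt (hline s)
    rw [InnerProductSpace.toDual_apply_apply] at h1
    exact h1
  have hg' : ∀ s : ℝ, HasDerivAt (fun s : ℝ => ⟪gradient f (x + s • h), h⟫)
      ⟪A (x + s • h) h, h⟫ s := by
    intro s
    have h1 : HasDerivAt (fun s : ℝ => gradient f (x + s • h)) (A (x + s • h) h) s :=
      HasFDerivAt.comp_hasDerivAt (f := fun s : ℝ => x + s • h) s (hA (x + s • h)) (hline s)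
    simpa using h1.inner ℝ (hasDerivAt_const s h)
  set χ : ℝ → ℝ := fun s => ⟪gradient f (x + s • h), h⟫ - ⟪gradient f x, h⟫ - s * ⟪A x h, h⟫
    - s ^ 2 * (M * ‖h‖ ^ 3 / 2) with hχ
  set ψ : ℝ → ℝ := fun s => f (x + s • h) - s * ⟪gradient f x, h⟫ - s ^ 2 * (⟪A x h, h⟫ / 2)
    - s ^ 3 * (M * ‖h‖ ^ 3 / 6) with hψ
  have hχ' : ∀ s, HasDerivAt χ (⟪A (x + s • h) h, h⟫ - ⟪A x h, h⟫ - s * (M * ‖h‖ ^ 3)) s := by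
    intro s
    have := (((hg' s).sub_const ⟪gradient f x, h⟫).sub
      ((hasDerivAt_id s).mul_const ⟪A x h, h⟫)).sub
      ((hasDerivAt_pow 2 s).mul_const (M * ‖h‖ ^ 3 / 2))
    refine this.congr_deriv ?_
    norm_num
    ring
  have hψ' : ∀ s, HasDerivAt ψ (χ s) s := by
    intro s
    have := (((hf' s).sub ((hasDerivAt_id s).mul_const ⟪gradient f x, h⟫)).sub
      ((hasDerivAt_pow 2 s).mul_const (⟪A x h, h⟫ / 2))).sub
      ((hasDerivAt_pow 3 s).mul_const (M * ‖h‖ ^ 3 / 6))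
    refine this.congr_deriv ?_
    simp only [hχ]
    norm_num
    ring
  have anti : ∀ u u' : ℝ → ℝ, (∀ s, HasDerivAt u (u' s) s) → (∀ s, 0 ≤ s → u' s ≤ 0) →
      AntitoneOn u (Set.Ici 0) := by
    intro u u' hu hneg
    refine antitoneOn_of_deriv_nonpos (convex_Ici 0)
      (fun s _ => (hu s).continuousAt.continuousWithinAt)
      (fun s _ => (hu s).differentiableAt.differentiableWithinAt) fun s hs => ?_
    rw [(hu s).deriv]
    exact hneg s (interior_subset hs)
  have hχ0 : ∀ s, 0 ≤ s → χ s ≤ 0 := by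
    intro s hs
    have h1 := anti χ _ hχ' (fun s hs => by
      have h2 : ⟪A (x + s • h) h, h⟫ - ⟪A x h, h⟫ ≤ ‖A (x + s • h) - A x‖ * ‖h‖ * ‖h‖ := by
        rw [← inner_sub_left, ← sub_apply]
        exact (real_inner_le_norm _ _).trans
          (mul_le_mul_of_nonneg_right (ContinuousLinearMap.le_opNorm _ _) (norm_nonneg _))
      have h3 : ‖A (x + s • h) - A x‖ ≤ M * (s * ‖h‖) := by
        simpa [norm_smul, abs_of_nonneg hs] using hM (x + s • h) x
      have h4 : ‖A (x + s • h) - A x‖ * ‖h‖ * ‖h‖ ≤ M * (s * ‖h‖) * ‖h‖ * ‖h‖ := by gcongr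
      nlinarith) (Set.self_mem_Ici) hs hs
    simpa [hχ] using h1
  have key := anti ψ χ hψ' hχ0 (Set.self_mem_Ici) (Set.mem_Ici.2 zero_le_one) zero_le_one
  simp only [hψ, one_smul, zero_smul, add_zero] at key
  unfold cubicModel
  linarith

/-- The model value at a global minimizer of the cubic model. -/
theorem cubicModel_le_of_isMin {g : E} {A : E →L[ℝ] E} {M : ℝ} {h : E}
    (hmin : ∀ y, cubicModel g A M h ≤ cubicModel g A M y) :
    cubicModel g A M h ≤ -(M / 12 * ‖h‖ ^ 3) := by
  have hneg := hmin (-h)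
  have hray : ∀ s : ℝ, 0 ≤ s → cubicModel g A M (s • h) =
      s * ⟪g, h⟫ + s ^ 2 * (⟪A h, h⟫ / 2) + s ^ 3 * (M / 6 * ‖h‖ ^ 3) := by
    intro s hs
    simp only [cubicModel, map_smul, inner_smul_left, inner_smul_right, norm_smul,
      Real.norm_eq_abs, abs_of_nonneg hs, RCLike.conj_to_real]
    ring
  have hderiv : HasDerivAt (fun s : ℝ =>
      s * ⟪g, h⟫ + s ^ 2 * (⟪A h, h⟫ / 2) + s ^ 3 * (M / 6 * ‖h‖ ^ 3))
      (⟪g, h⟫ + ⟪A h, h⟫ + M / 2 * ‖h‖ ^ 3) 1 := by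
    have := (((hasDerivAt_id (1 : ℝ)).mul_const ⟪g, h⟫).add
      ((hasDerivAt_pow 2 (1 : ℝ)).mul_const (⟪A h, h⟫ / 2))).add
      ((hasDerivAt_pow 3 (1 : ℝ)).mul_const (M / 6 * ‖h‖ ^ 3))
    refine this.congr_deriv ?_
    norm_num
    ring
  have hloc : IsLocalMin (fun s : ℝ =>
      s * ⟪g, h⟫ + s ^ 2 * (⟪A h, h⟫ / 2) + s ^ 3 * (M / 6 * ‖h‖ ^ 3)) 1 := by
    filter_upwards [eventually_ge_nhds (zero_lt_one (α := ℝ))] with s hs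
    have h1 := hmin (s • h)
    rw [hray s hs] at h1
    have h2 := hray 1 zero_le_one
    rw [one_smul] at h2
    linarith
  have hfirst := hloc.hasDerivAt_eq_zero hderiv
  simp only [cubicModel, map_neg, inner_neg_left, inner_neg_right, norm_neg, neg_neg] at hneg
  unfold cubicModel
  linarith

/-- The gradient is controlled by the length of the cubic-regularized Newton step. -/
theorem norm_gradient_le_of_isMin {g : E} {A : E →L[ℝ] E} {M L : ℝ} {h : E} (hM : 0 ≤ M)
    (hL : 0 ≤ L) (hA : ‖A‖ ≤ L) (hmin : ∀ y, cubicModel g A M h ≤ cubicModel g A M y) :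
    ‖g‖ ≤ 4 * L * ‖h‖ + 4 / 3 * M * ‖h‖ ^ 2 := by
  have hquad : ∀ v : E, |⟪A v, v⟫| ≤ L * ‖v‖ ^ 2 := by
    intro v
    calc |⟪A v, v⟫| ≤ ‖A v‖ * ‖v‖ := abs_real_inner_le_norm _ _
      _ ≤ L * ‖v‖ * ‖v‖ := by gcongr; exact A.le_of_opNorm_le hA v
      _ = L * ‖v‖ ^ 2 := by ring
  rcases eq_or_ne g 0 with rfl | hg
  · rw [norm_zero]; positivity
  have hgpos : 0 < ‖g‖ := norm_pos_iff.2 hg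
  have hbound : ∀ s, 2 * ‖h‖ < s → ‖g‖ ≤ 2 * L * s + M / 3 * s ^ 2 := by
    intro s hs
    have hr := norm_nonneg h
    have hs0 : 0 < s := by linarith
    have hy := hmin (-(s / ‖g‖) • g)
    have hnorm : ‖-(s / ‖g‖) • g‖ = s := by
      rw [norm_smul, norm_neg, Real.norm_of_nonneg (by positivity)]
      field_simp
    have hin : ⟪g, -(s / ‖g‖) • g⟫ = -(s * ‖g‖) := by
      rw [inner_smul_right, real_inner_self_eq_norm_sq]
      field_simp
    have h1 := (abs_le.1 (hquad (-(s / ‖g‖) • g))).2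
    rw [hnorm] at h1
    have h2 := (abs_le.1 (hquad h)).1
    have h3 := (abs_le.1 (abs_real_inner_le_norm g h)).1
    unfold cubicModel at hy
    rw [hnorm, hin] at hy
    have h4 : 0 ≤ M / 6 * ‖h‖ ^ 3 := by positivity
    have h5 : L * ‖h‖ ^ 2 ≤ L * s ^ 2 := by gcongr; linarith
    have h6 : ‖g‖ * ‖h‖ ≤ ‖g‖ * (s / 2) := by gcongr; linarith
    refine le_of_mul_le_mul_left ?_ hs0
    nlinarith
  have hlim : Filter.Tendsto (fun s : ℝ => 2 * L * s + M / 3 * s ^ 2)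
      (nhdsWithin (2 * ‖h‖) (Set.Ioi (2 * ‖h‖)))
      (nhds (2 * L * (2 * ‖h‖) + M / 3 * (2 * ‖h‖) ^ 2)) :=
    (Continuous.tendsto (by fun_prop) _).mono_left nhdsWithin_le_nhds
  have := ge_of_tendsto hlim (eventually_nhdsWithin_of_forall hbound)
  linarith

/-- Negative curvature is controlled by the length of the cubic-regularized Newton step. -/
theorem neg_le_inner_of_isMin {g : E} {A : E →L[ℝ] E} {M : ℝ} {h : E} (hM : 0 ≤ M)
    (hmin : ∀ y, cubicModel g A M h ≤ cubicModel g A M y) {v : E} (hv : ‖v‖ = 1) :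
    -(4 / 3 * M * ‖h‖) ≤ ⟪A v, v⟫ := by
  have hbound : ∀ s, ‖h‖ < s → -(4 / 3 * M * s) ≤ ⟪A v, v⟫ := by
    intro s hs
    have hr := norm_nonneg h
    have hs0 : 0 < s := by linarith
    have hsv : ‖s • v‖ = s := by rw [norm_smul, hv, Real.norm_of_nonneg hs0.le, mul_one]
    have hp := hmin (h + s • v)
    have hm := hmin (h - s • v)
    have h1 : ‖h + s • v‖ ≤ 2 * s := by linarith [norm_add_le h (s • v)]
    have h2 : ‖h - s • v‖ ≤ 2 * s := by linarith [norm_sub_le h (s • v)]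
    have hpar := parallelogram_law_with_norm ℝ h (s • v)
    rw [hsv] at hpar
    have h3 : ‖h + s • v‖ ^ 3 ≤ 2 * s * (‖h + s • v‖ * ‖h + s • v‖) := by
      rw [pow_succ', sq]; gcongr
    have h4 : ‖h - s • v‖ ^ 3 ≤ 2 * s * (‖h - s • v‖ * ‖h - s • v‖) := by
      rw [pow_succ', sq]; gcongr
    have h5 : ‖h‖ * ‖h‖ ≤ s * s := by gcongr
    have h6 : ‖h + s • v‖ ^ 3 + ‖h - s • v‖ ^ 3 ≤ 8 * s ^ 3 := by
      have : 2 * s * (‖h + s • v‖ * ‖h + s • v‖ + ‖h - s • v‖ * ‖h - s • v‖) ≤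
          2 * s * (4 * (s * s)) := by
        gcongr; linarith
      linarith
    have h7 : M / 6 * (‖h + s • v‖ ^ 3 + ‖h - s • v‖ ^ 3) ≤ M / 6 * (8 * s ^ 3) := by gcongr
    have h8 : 0 ≤ M / 6 * ‖h‖ ^ 3 := by positivity
    simp only [cubicModel, map_add, map_sub, map_smul, inner_add_left, inner_add_right,
      inner_sub_left, inner_sub_right, inner_smul_left, inner_smul_right,
      RCLike.conj_to_real] at hp hm
    refine le_of_mul_le_mul_left ?_ (pow_pos hs0 2)
    nlinarith
  have hlim : Filter.Tendsto (fun s : ℝ => -(4 / 3 * M * s)) (nhdsWithin ‖h‖ (Set.Ioi ‖h‖))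
      (nhds (-(4 / 3 * M * ‖h‖))) :=
    (Continuous.tendsto (by fun_prop) _).mono_left nhdsWithin_le_nhds
  exact le_of_tendsto hlim (eventually_nhdsWithin_of_forall hbound)

end CubicModel

theorem le_lambdaMin {d : ℕ} (hd : 1 ≤ d) {A : Matrix (Fin d) (Fin d) ℝ} {c : ℝ}
    (h : ∀ v : EuclideanSpace ℝ (Fin d), ‖v‖ = 1 →
      c ≤ ⟪(Matrix.toEuclideanCLM (𝕜 := ℝ) A) v, v⟫) : c ≤ lambdaMin A := by
  refine le_csInf ⟨_, EuclideanSpace.single ⟨0, hd⟩ 1, by simp, rfl⟩ ?_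
  rintro r ⟨v, hv, rfl⟩
  exact h v hv

/-- Telescoping for a drifting sequence of functions. -/
theorem sum_sub_le_add_variation {X : Type*} (f : ℕ → X → ℝ) (x : ℕ → X) (T : ℕ)
    (hbdd : ∀ t ∈ Finset.Icc 1 T, BddAbove (Set.range fun y => |f t y - f (t + 1) y|)) :
    ∑ t ∈ Finset.Icc 1 (T + 1), (f t (x t) - f t (x (t + 1))) ≤
      f 1 (x 1) - f (T + 1) (x (T + 2)) + ∑ t ∈ Finset.Icc 1 T, ⨆ y, |f t y - f (t + 1) y| := by
  induction T with
  | zero => simp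
  | succ T ih =>
    have ih := ih fun t ht => hbdd t (Finset.Icc_subset_Icc_right (Nat.le_succ T) ht)
    rw [Finset.sum_Icc_succ_top (by omega),
      Finset.sum_Icc_succ_top (by omega) fun t => ⨆ y, |f t y - f (t + 1) y|]
    have h1 := le_ciSup (hbdd (T + 1) (by simp)) (x (T + 2))
    have h2 := neg_le_abs (f (T + 1) (x (T + 2)) - f (T + 1 + 1) (x (T + 2)))
    simp only [add_assoc, Nat.reduceAdd] at *
    linarith

theorem sum_le_rpow_mul_one_add_sum_pow_three {T : ℕ} (hT : 1 ≤ T) {r : ℕ → ℝ}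
    (hr : ∀ t, 0 ≤ r t) :
    ∑ t ∈ Finset.Icc 1 T, r t ≤
      (T : ℝ) ^ ((2 : ℝ) / 3) * (1 + ∑ t ∈ Finset.Icc 1 T, r t ^ 3) := by
  have hT0 : (0 : ℝ) < T := by exact_mod_cast hT
  obtain ⟨q, hq⟩ : ∃ q : ℝ, q = (T : ℝ) ^ ((1 : ℝ) / 3) := ⟨_, rfl⟩
  have hq0 : 0 < q := hq ▸ Real.rpow_pos_of_pos hT0 _
  have hq2 : (T : ℝ) ^ ((2 : ℝ) / 3) = q ^ 2 := by
    rw [hq, ← Real.rpow_natCast, ← Real.rpow_mul hT0.le]; norm_num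
  have hq3 : (T : ℝ) = q ^ 3 := by
    rw [hq, ← Real.rpow_natCast, ← Real.rpow_mul hT0.le]; norm_num
  have hterm : ∀ s : ℝ, 0 ≤ s → s ≤ 1 / q + q ^ 2 * s ^ 3 := by
    intro s hs
    rcases le_total (q * s) 1 with h | h
    · have : s ≤ 1 / q := by rw [le_div_iff₀ hq0]; linarith
      have : 0 ≤ q ^ 2 * s ^ 3 := by positivity
      linarith
    · have h1 : s * 1 ≤ s * (q * s) ^ 2 := by gcongr; exact one_le_pow₀ h
      have : 0 ≤ 1 / q := by positivity
      nlinarith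
  calc ∑ t ∈ Finset.Icc 1 T, r t ≤ ∑ t ∈ Finset.Icc 1 T, (1 / q + q ^ 2 * r t ^ 3) :=
        Finset.sum_le_sum fun t _ => hterm _ (hr t)
    _ = (T : ℝ) * (1 / q) + q ^ 2 * ∑ t ∈ Finset.Icc 1 T, r t ^ 3 := by
        rw [Finset.sum_add_distrib, ← Finset.mul_sum]; simp
    _ = (T : ℝ) ^ ((2 : ℝ) / 3) * (1 + ∑ t ∈ Finset.Icc 1 T, r t ^ 3) := by
        rw [hq2, hq3]; field_simp

/-- **Second-order nonstationary regret of the online cubic-regularized Newton method.**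
For every `L_G, L_H > 0` there is a constant `C > 0`, depending only on `L_G` and `L_H`,
such that for all dimensions `d ≥ 1`, horizons `T ≥ 1`, variation budgets `W_T ≥ 0`, all
sequences `f_1, …, f_T` of functions with `L_G`-Lipschitz gradients and `L_H`-Lipschitz
Hessians whose total variation `∑_t sup_x |f_t x − f_{t+1} x|` is at most `W_T`, and all
iterate sequences where `x_{t+1}` globally minimizes the cubic model of `f_t` at `x_t` with
regularization `M = L_H`, the cumulative second-order stationarity regret is at most
`C T^{2/3} (1 + W_T + max 0 (f_1(x_1) − f_T(x_{T+1})))`. -/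
theorem online_cubic_newton_second_order_regret
    (L_G L_H : ℝ) (hLG : 0 < L_G) (hLH : 0 < L_H) :
    ∃ C : ℝ, 0 < C ∧
      ∀ (d T : ℕ), 1 ≤ d → 1 ≤ T → ∀ (W_T : ℝ), 0 ≤ W_T →
      ∀ (f : ℕ → EuclideanSpace ℝ (Fin d) → ℝ)
        (Hf : ℕ → EuclideanSpace ℝ (Fin d) → Matrix (Fin d) (Fin d) ℝ)
        (x : ℕ → EuclideanSpace ℝ (Fin d)),
      (∀ t ∈ Finset.Icc 1 T, Differentiable ℝ (f t)) →
      (∀ t ∈ Finset.Icc 1 T, ∀ a b,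
        ‖gradient (f t) a - gradient (f t) b‖ ≤ L_G * ‖a - b‖) →
      (∀ t ∈ Finset.Icc 1 T, ∀ y, HasFDerivAt (fun z => gradient (f t) z)
        (Matrix.toEuclideanCLM (𝕜 := ℝ) (Hf t y)) y) →
      (∀ t ∈ Finset.Icc 1 T, ∀ y, (Hf t y).IsHermitian) →
      (∀ t ∈ Finset.Icc 1 T, ∀ a b, matOpNorm (Hf t a - Hf t b) ≤ L_H * ‖a - b‖) →
      (∀ t ∈ Finset.Icc 1 (T - 1),
        BddAbove (Set.range fun y => |f t y - f (t + 1) y|)) →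
      (∑ t ∈ Finset.Icc 1 (T - 1), ⨆ y, |f t y - f (t + 1) y|) ≤ W_T →
      (∀ t ∈ Finset.Icc 1 T, ∀ y : EuclideanSpace ℝ (Fin d),
        ⟪gradient (f t) (x t), x (t + 1) - x t⟫
          + (1 / 2) * ⟪(Matrix.toEuclideanCLM (𝕜 := ℝ) (Hf t (x t))) (x (t + 1) - x t),
              x (t + 1) - x t⟫
          + (L_H / 6) * ‖x (t + 1) - x t‖ ^ 3 ≤
        ⟪gradient (f t) (x t), y - x t⟫
          + (1 / 2) * ⟪(Matrix.toEuclideanCLM (𝕜 := ℝ) (Hf t (x t))) (y - x t), y - x t⟫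
          + (L_H / 6) * ‖y - x t‖ ^ 3) →
      (∑ t ∈ Finset.Icc 1 T,
          max ‖gradient (f t) (x t)‖ ((-(2 / L_H) * lambdaMin (Hf t (x t))) ^ 3)) ≤
        C * (T : ℝ) ^ ((2 : ℝ) / 3)
          * (1 + W_T + max 0 (f 1 (x 1) - f T (x (T + 1)))) := by
  refine ⟨(4 * L_G + 4 / 3 * L_H + 19) * (2 * (1 + 12 / L_H)), by positivity, ?_⟩
  intro d T hd hT W hW f Hf x hdiff hlip hhess _ hHlip hbdd hvar hmin
  set r : ℕ → ℝ := fun t => ‖x (t + 1) - x t‖ with hr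
  have hr0 : ∀ t, 0 ≤ r t := fun t => norm_nonneg _
  have hmodel : ∀ t ∈ Finset.Icc 1 T, ∀ y,
      cubicModel (gradient (f t) (x t)) (Matrix.toEuclideanCLM (𝕜 := ℝ) (Hf t (x t))) L_H
        (x (t + 1) - x t) ≤
      cubicModel (gradient (f t) (x t)) (Matrix.toEuclideanCLM (𝕜 := ℝ) (Hf t (x t))) L_H y := by
    intro t ht y
    have := hmin t ht (x t + y)
    rw [add_sub_cancel_left] at this
    exact this
  have hdecr : ∀ t ∈ Finset.Icc 1 T,
      r t ^ 3 ≤ 12 / L_H * (f t (x t) - f t (x (t + 1))) := by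
    intro t ht
    have h1 := le_add_cubicModel_of_lipschitz_hessian (hdiff t ht) (hhess t ht)
      (M := L_H) (fun a b => by simpa [matOpNorm] using hHlip t ht a b) (x t) (x (t + 1) - x t)
    rw [add_sub_cancel] at h1
    have h2 := cubicModel_le_of_isMin (hmodel t ht)
    have h3 : L_H / 12 * r t ^ 3 ≤ f t (x t) - f t (x (t + 1)) := by
      simp only [hr]; linarith
    calc r t ^ 3 = 12 / L_H * (L_H / 12 * r t ^ 3) := by field_simp
      _ ≤ _ := by gcongr
  have hterm : ∀ t ∈ Finset.Icc 1 T,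
      max ‖gradient (f t) (x t)‖ ((-(2 / L_H) * lambdaMin (Hf t (x t))) ^ 3) ≤
        (4 * L_G + 4 / 3 * L_H + 19) * (r t + r t ^ 3) := by
    intro t ht
    have hA : ‖Matrix.toEuclideanCLM (𝕜 := ℝ) (Hf t (x t))‖ ≤ L_G :=
      (hhess t ht (x t)).le_of_lip' hLG.le (Filter.Eventually.of_forall fun y => hlip t ht y (x t))
    have hg : ‖gradient (f t) (x t)‖ ≤ 4 * L_G * r t + 4 / 3 * L_H * r t ^ 2 :=
      norm_gradient_le_of_isMin hLH.le hLG.le hA (hmodel t ht)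
    have hl : -(4 / 3 * L_H * r t) ≤ lambdaMin (Hf t (x t)) :=
      le_lambdaMin hd fun v hv => neg_le_inner_of_isMin hLH.le (hmodel t ht) hv
    have hrt := hr0 t
    have hr3 : 0 ≤ r t ^ 3 := by positivity
    refine max_le ?_ ?_
    · have h2 : r t ^ 2 ≤ r t + r t ^ 3 := by
        nlinarith [mul_nonneg hrt (sq_nonneg (r t - 1)), mul_nonneg hrt hrt]
      have h3 : 4 / 3 * L_H * r t ^ 2 ≤ 4 / 3 * L_H * (r t + r t ^ 3) := by gcongr
      have h4 : 0 ≤ 4 * L_G * r t ^ 3 := by positivity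
      linarith
    · have h1 : -(2 / L_H) * lambdaMin (Hf t (x t)) ≤ 8 / 3 * r t := by
        have : 2 / L_H * -(4 / 3 * L_H * r t) ≤ 2 / L_H * lambdaMin (Hf t (x t)) := by gcongr
        have e : 2 / L_H * -(4 / 3 * L_H * r t) = -(8 / 3 * r t) := by field_simp; ring
        linarith
      have h2 : (-(2 / L_H) * lambdaMin (Hf t (x t))) ^ 3 ≤ (8 / 3 * r t) ^ 3 :=
        (Odd.pow_le_pow (by decide)).2 h1
      have h3 : 0 ≤ (4 * L_G + 4 / 3 * L_H) * (r t + r t ^ 3) := by positivity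
      nlinarith
  set D := f 1 (x 1) - f T (x (T + 1))
  have hS : ∑ t ∈ Finset.Icc 1 T, r t ^ 3 ≤ 12 / L_H * (W + max 0 D) := by
    obtain ⟨n, rfl⟩ : ∃ n, T = n + 1 := ⟨T - 1, by omega⟩
    have h1 := sum_sub_le_add_variation f x n hbdd
    have h2 : f 1 (x 1) - f (n + 1) (x (n + 2)) ≤ max 0 D := le_max_right 0 D
    calc ∑ t ∈ Finset.Icc 1 (n + 1), r t ^ 3
        ≤ ∑ t ∈ Finset.Icc 1 (n + 1), 12 / L_H * (f t (x t) - f t (x (t + 1))) :=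
          Finset.sum_le_sum hdecr
      _ = 12 / L_H * ∑ t ∈ Finset.Icc 1 (n + 1), (f t (x t) - f t (x (t + 1))) := by
          rw [Finset.mul_sum]
      _ ≤ 12 / L_H * (W + max 0 D) := by
          gcongr
          simp only [Nat.add_sub_cancel] at hvar
          linarith
  set S := ∑ t ∈ Finset.Icc 1 T, r t ^ 3
  set Q := (T : ℝ) ^ ((2 : ℝ) / 3)
  have hS0 : 0 ≤ S := Finset.sum_nonneg fun t _ => pow_nonneg (hr0 t) 3
  have hQ : 1 ≤ Q := Real.one_le_rpow (by exact_mod_cast hT) (by norm_num)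
  have hm : 0 ≤ max 0 D := le_max_left _ _
  have hsum : ∑ t ∈ Finset.Icc 1 T, r t ≤ Q * (1 + S) :=
    sum_le_rpow_mul_one_add_sum_pow_three hT hr0
  have hZ : 1 + S ≤ (1 + 12 / L_H) * (1 + W + max 0 D) := by
    have : 0 ≤ 12 / L_H := by positivity
    nlinarith
  calc _ ≤ ∑ t ∈ Finset.Icc 1 T, (4 * L_G + 4 / 3 * L_H + 19) * (r t + r t ^ 3) :=
        Finset.sum_le_sum hterm
    _ = (4 * L_G + 4 / 3 * L_H + 19) * (∑ t ∈ Finset.Icc 1 T, r t + S) := by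
        rw [← Finset.mul_sum, Finset.sum_add_distrib]
    _ ≤ (4 * L_G + 4 / 3 * L_H + 19) * (2 * (Q * (1 + S))) := by
        gcongr
        nlinarith
    _ ≤ (4 * L_G + 4 / 3 * L_H + 19) * (2 * (Q * ((1 + 12 / L_H) * (1 + W + max 0 D)))) := by
        gcongr
    _ = _ := by ring
end

section
/- Let d ≥ 1 and let X ⊆ ℝ^d be a nonempty closed convex set with ‖p − q‖ ≤ R for all p, q ∈ X (diameter at most R). Let x, a, b ∈ X, G ∈ ℝ^d, η > 0, and let x⁺ ∈ X satisfy ‖(x − ηG) − x⁺‖ ≤ ‖(x − ηG) − z‖ for all z ∈ X (i.e., x⁺ is a nearest point of X to x − ηG). Then 2η·⟨G, x − a⟩ ≤ ‖x − a‖² − ‖x⁺ − b‖² + η²·‖G‖² + 3R·‖a − b‖. -/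
open scoped RealInnerProductSpace

/-- A nearest point `v` of a convex set `K` to `u` satisfies the variational inequality. -/
theorem inner_sub_nonpos_of_forall_norm_sub_le {E : Type*} [NormedAddCommGroup E]
    [InnerProductSpace ℝ E] {K : Set E} (hK : Convex ℝ K) {u v : E} (hv : v ∈ K)
    (hmin : ∀ z ∈ K, ‖u - v‖ ≤ ‖u - z‖) {w : E} (hw : w ∈ K) : ⟪u - v, w - v⟫ ≤ 0 := by
  have : Nonempty K := ⟨⟨v, hv⟩⟩
  refine (norm_eq_iInf_iff_real_inner_le_zero hK hv).1 (le_antisymm ?_ ?_) w hw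
  · exact le_ciInf fun z => hmin z z.2
  · exact ciInf_le (f := fun z : K => ‖u - z‖)
      ⟨0, Set.forall_mem_range.2 fun _ => norm_nonneg _⟩ ⟨v, hv⟩

/-- Moving to a nearest point of a convex set does not increase the distance to its points. -/
theorem norm_sub_sq_le_of_forall_norm_sub_le {E : Type*} [NormedAddCommGroup E]
    [InnerProductSpace ℝ E] {K : Set E} (hK : Convex ℝ K) {u v : E} (hv : v ∈ K)
    (hmin : ∀ z ∈ K, ‖u - v‖ ≤ ‖u - z‖) {w : E} (hw : w ∈ K) :
    ‖v - w‖ ^ 2 ≤ ‖u - w‖ ^ 2 := by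
  have hinner := inner_sub_nonpos_of_forall_norm_sub_le hK hv hmin hw
  have hexpand := norm_sub_sq_real (u - v) (w - v)
  rw [sub_sub_sub_cancel_right, norm_sub_rev w v] at hexpand
  nlinarith [sq_nonneg ‖u - v‖]

/-- **Per-step projected gradient inequality with a moving comparator pair.**
Let `X ⊆ ℝ^d` be a nonempty closed convex set of diameter at most `R`, let `x, a, b ∈ X`,
`G ∈ ℝ^d`, `η > 0`, and let `x⁺ ∈ X` be a nearest point of `X` to `x − η G`. Then
`2η ⟪G, x − a⟫ ≤ ‖x − a‖² − ‖x⁺ − b‖² + η² ‖G‖² + 3R ‖a − b‖`. -/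
theorem projected_gradient_step_inequality
    (d : ℕ) (hd : 1 ≤ d) (X : Set (EuclideanSpace ℝ (Fin d)))
    (hXne : X.Nonempty) (hXclosed : IsClosed X) (hXconv : Convex ℝ X)
    (R : ℝ) (hdiam : ∀ p ∈ X, ∀ q ∈ X, ‖p - q‖ ≤ R)
    (x a b : EuclideanSpace ℝ (Fin d)) (hx : x ∈ X) (ha : a ∈ X) (hb : b ∈ X)
    (G : EuclideanSpace ℝ (Fin d)) (η : ℝ) (hη : 0 < η)
    (xplus : EuclideanSpace ℝ (Fin d)) (hxplus : xplus ∈ X)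
    (hnear : ∀ z ∈ X, ‖(x - η • G) - xplus‖ ≤ ‖(x - η • G) - z‖) :
    2 * η * ⟪G, x - a⟫ ≤
      ‖x - a‖ ^ 2 - ‖xplus - b‖ ^ 2 + η ^ 2 * ‖G‖ ^ 2 + 3 * R * ‖a - b‖ := by
  have hproj := norm_sub_sq_le_of_forall_norm_sub_le hXconv hxplus hnear ha
  have hexpand : ‖x - η • G - a‖ ^ 2 =
      ‖x - a‖ ^ 2 - 2 * η * ⟪G, x - a⟫ + η ^ 2 * ‖G‖ ^ 2 := by
    rw [sub_right_comm, norm_sub_sq_real, real_inner_smul_right, real_inner_comm, norm_smul,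
      mul_pow, Real.norm_eq_abs, sq_abs]
    ring
  have htri : ‖xplus - b‖ ≤ ‖xplus - a‖ + ‖a - b‖ := norm_sub_le_norm_sub_add_norm_sub _ _ _
  have hpa := hdiam xplus hxplus a ha
  have hab := hdiam a ha b hb
  have hmove : ‖xplus - b‖ ^ 2 ≤ ‖xplus - a‖ ^ 2 + 3 * R * ‖a - b‖ := by
    have hsq := pow_le_pow_left₀ (norm_nonneg (xplus - b)) htri 2
    have h₁ := mul_le_mul_of_nonneg_right hpa (norm_nonneg (a - b))
    have h₂ := mul_le_mul_of_nonneg_right hab (norm_nonneg (a - b))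
    linarith [add_sq ‖xplus - a‖ ‖a - b‖, sq ‖a - b‖]
  linarith
end

section
/- Let d ≥ 1 and let f : ℝ^d → ℝ have L_G-Lipschitz gradient and L_H-Lipschitz Hessian, with L_G, L_H > 0. Let M > 0, let x, g, h ∈ ℝ^d, and let H be a symmetric d×d real matrix such that g + Hh + (M/2)·‖h‖·h = 0. Then ‖∇f(x)‖ ≤ L_G·‖h‖ + ‖∇f(x) − g‖ + ‖∇²f(x) − H‖_op²/(2(L_H + M)) + (L_H + M)·‖h‖². -/
open scoped RealInnerProductSpace

/-- **Gradient-size bound from the cubic-step stationarity equation.**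
If `f` has `L_G`-Lipschitz gradient and `L_H`-Lipschitz Hessian `Hf`, and `(g, H, h)` satisfy
the first-order stationarity equation `g + H h + (M/2)‖h‖ h = 0` of the cubic-regularized
Newton step with regularization `M`, then
`‖∇f x‖ ≤ L_G ‖h‖ + ‖∇f x − g‖ + ‖∇²f x − H‖_op²/(2(L_H + M)) + (L_H + M)‖h‖²`. -/
theorem gradient_bound_from_cubic_stationarity
    (d : ℕ) (hd : 1 ≤ d) (L_G L_H M : ℝ) (hLG : 0 < L_G) (hLH : 0 < L_H) (hM : 0 < M)
    (f : EuclideanSpace ℝ (Fin d) → ℝ) (hf : Differentiable ℝ f)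
    (hGradLip : ∀ a b, ‖gradient f a - gradient f b‖ ≤ L_G * ‖a - b‖)
    (Hf : EuclideanSpace ℝ (Fin d) → Matrix (Fin d) (Fin d) ℝ)
    (hHess : ∀ y, HasFDerivAt (fun z => gradient f z)
      (Matrix.toEuclideanCLM (𝕜 := ℝ) (Hf y)) y)
    (hHsymm : ∀ y, (Hf y).IsHermitian)
    (hHessLip : ∀ a b, matOpNorm (Hf a - Hf b) ≤ L_H * ‖a - b‖)
    (x g h : EuclideanSpace ℝ (Fin d)) (H : Matrix (Fin d) (Fin d) ℝ)
    (hHsym : H.IsHermitian)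
    (hstat : g + (Matrix.toEuclideanCLM (𝕜 := ℝ) H) h + ((M / 2) * ‖h‖) • h = 0) :
    ‖gradient f x‖ ≤
      L_G * ‖h‖ + ‖gradient f x - g‖
        + (matOpNorm (Hf x - H)) ^ 2 / (2 * (L_H + M)) + (L_H + M) * ‖h‖ ^ 2 := by
  have hHf : ‖Matrix.toEuclideanCLM (𝕜 := ℝ) (Hf x)‖ ≤ L_G :=
    (hHess x).le_of_lip' hLG.le (Filter.Eventually.of_forall fun y => hGradLip y x)
  have hg : gradient f x = (gradient f x - g) - Matrix.toEuclideanCLM (𝕜 := ℝ) (Hf x) h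
      + Matrix.toEuclideanCLM (𝕜 := ℝ) (Hf x - H) h - ((M / 2) * ‖h‖) • h := by
    rw [map_sub, sub_apply, ← sub_eq_zero, ← hstat]
    abel
  have hHf_apply : ‖Matrix.toEuclideanCLM (𝕜 := ℝ) (Hf x) h‖ ≤ L_G * ‖h‖ :=
    ContinuousLinearMap.le_of_opNorm_le _ hHf h
  have hDiff_apply : ‖Matrix.toEuclideanCLM (𝕜 := ℝ) (Hf x - H) h‖
      ≤ matOpNorm (Hf x - H) * ‖h‖ :=
    ContinuousLinearMap.le_opNorm _ h
  have hReg : ‖((M / 2) * ‖h‖) • h‖ = M / 2 * ‖h‖ ^ 2 := by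
    rw [norm_smul, Real.norm_of_nonneg (by positivity)]
    ring
  have hTriangle : ‖gradient f x‖ ≤ ‖gradient f x - g‖ + L_G * ‖h‖
      + matOpNorm (Hf x - H) * ‖h‖ + M / 2 * ‖h‖ ^ 2 := by
    conv_lhs => rw [hg]
    refine (norm_sub_le _ _).trans (add_le_add ?_ hReg.le)
    refine (norm_add_le _ _).trans (add_le_add ?_ hDiff_apply)
    exact (norm_sub_le _ _).trans (add_le_add le_rfl hHf_apply)
  have hYoung : matOpNorm (Hf x - H) * ‖h‖
      ≤ matOpNorm (Hf x - H) ^ 2 / (2 * (L_H + M)) + (L_H + M) / 2 * ‖h‖ ^ 2 := by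
    have hc : 0 < L_H + M := by positivity
    rw [← sub_nonneg]
    have hSquare : matOpNorm (Hf x - H) ^ 2 / (2 * (L_H + M)) + (L_H + M) / 2 * ‖h‖ ^ 2
        - matOpNorm (Hf x - H) * ‖h‖
        = (matOpNorm (Hf x - H) - (L_H + M) * ‖h‖) ^ 2 / (2 * (L_H + M)) := by
      field_simp
      ring
    rw [hSquare]
    positivity
  have hLr : 0 ≤ L_H * ‖h‖ ^ 2 := by positivity
  linarith
end
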